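/- arXiv:1506.01240 — 3 statements merged into one kernel-verified Lean document; each statement's English description precedes it below -/
import Mathlib

section
/- If a connected acyclic graph G admits a topological integer additive set-graceful labeling with respect to a ground set X with |X| ≥ 2, then G is isomorphic to the star K_{1, 2^{|X|} − 2}. -/
open Finset Pointwise

/-- `f` is an integer additive set-graceful labeling (IASGL) of `G` with respect to the
ground set `X`: `f` is injective, assigns nonempty subsets of `X` to vertices, the induced
edge function `f⁺(uv) = f u + f v` (sumset) is injective on edges, and its image is exactly
the collection of subsets of `X` other than `∅` and `{0}`. -/
def IsIASGL {V : Type*} (G : SimpleGraph V) (X : Finset ℕ) (f : V → Finset ℕ) : Prop :=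
  Function.Injective f ∧
  (∀ v, (f v).Nonempty ∧ f v ⊆ X) ∧
  (∀ u v u' v', G.Adj u v → G.Adj u' v' → f u + f v = f u' + f v' → s(u, v) = s(u', v')) ∧
  (∀ A : Finset ℕ, (∃ u v, G.Adj u v ∧ f u + f v = A) ↔ A ⊆ X ∧ A.Nonempty ∧ A ≠ {0})

/-- `T` is a topology on the finite ground set `X`: a family of subsets of `X`
containing `∅` and `X` and closed under pairwise unions and intersections. -/
def IsTopologyFamily (X : Finset ℕ) (T : Set (Finset ℕ)) : Prop :=
  (∀ A ∈ T, A ⊆ X) ∧ (∅ : Finset ℕ) ∈ T ∧ X ∈ T ∧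
  (∀ A ∈ T, ∀ B ∈ T, A ∪ B ∈ T) ∧ (∀ A ∈ T, ∀ B ∈ T, A ∩ B ∈ T)

/-- `f` is a topological integer additive set-labeling (Top-IASL) of `G` w.r.t. `X`. -/
def IsTopIASL {V : Type*} (G : SimpleGraph V) (X : Finset ℕ) (f : V → Finset ℕ) : Prop :=
  Function.Injective f ∧
  (∀ v, (f v).Nonempty ∧ f v ⊆ X) ∧
  (∀ u v, G.Adj u v → f u + f v ⊆ X) ∧
  IsTopologyFamily X (insert ∅ (Set.range f))

/-- `f` is a topological integer additive set-graceful labeling (Top-IASGL) of `G`. -/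
def IsTopIASGL {V : Type*} (G : SimpleGraph V) (X : Finset ℕ) (f : V → Finset ℕ) : Prop :=
  IsIASGL G X f ∧ IsTopologyFamily X (insert ∅ (Set.range f))

lemma sup_id_add {A B : Finset ℕ} (hA : A.Nonempty) (hB : B.Nonempty) :
    (A + B).sup id = A.sup id + B.sup id := by
  apply le_antisymm
  · refine Finset.sup_le fun x hx => ?_
    obtain ⟨a, ha, b, hb, rfl⟩ := Finset.mem_add.1 hx
    exact add_le_add (Finset.le_sup (f := id) ha) (Finset.le_sup (f := id) hb)
  · obtain ⟨a, ha, ha'⟩ := Finset.exists_mem_eq_sup A hA id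
    obtain ⟨b, hb, hb'⟩ := Finset.exists_mem_eq_sup B hB id
    rw [ha', hb']
    exact Finset.le_sup (f := id) (Finset.add_mem_add ha hb)

lemma eq_singleton_zero_iff_sup_id {A : Finset ℕ} (hA : A.Nonempty) :
    A = {0} ↔ A.sup id = 0 := by
  constructor
  · rintro rfl
    simp
  · intro h
    refine Finset.eq_singleton_iff_nonempty_unique_mem.2 ⟨hA, fun x hx => ?_⟩
    exact Nat.le_zero.1 (h ▸ Finset.le_sup (f := id) hx)

/-- Summing over darts a function of the edge label counts every label twice. -/
lemma IsIASGL.sum_darts {V : Type*} [Fintype V] {G : SimpleGraph V} [DecidableRel G.Adj]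
    {X : Finset ℕ} {f : V → Finset ℕ} (hf : IsIASGL G X f) (g : Finset ℕ → ℕ) :
    ∑ d : G.Dart, g (f d.fst + f d.snd) = 2 * ∑ C ∈ (X.powerset.erase ∅).erase {0}, g C := by
  classical
  obtain ⟨-, -, hinj, him⟩ := hf
  rw [← Finset.sum_fiberwise_of_maps_to (t := (X.powerset.erase ∅).erase {0})
    (g := fun d : G.Dart => f d.fst + f d.snd), Finset.mul_sum]
  · refine Finset.sum_congr rfl fun C hC => ?_
    simp only [Finset.mem_erase, Finset.mem_powerset] at hC
    obtain ⟨u, v, huv, rfl⟩ := (him C).2 ⟨hC.2.2, Finset.nonempty_iff_ne_empty.2 hC.2.1, hC.1⟩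
    let d₀ : G.Dart := ⟨(u, v), huv⟩
    have hfib : (Finset.univ.filter fun d : G.Dart => f d.fst + f d.snd = f u + f v)
        = {d₀, d₀.symm} := by
      ext d
      simp only [Finset.mem_filter, Finset.mem_univ, true_and, Finset.mem_insert,
        Finset.mem_singleton]
      rw [← SimpleGraph.dart_edge_eq_iff]
      constructor
      · exact fun h => hinj _ _ _ _ d.adj huv h
      · intro h
        rcases (SimpleGraph.dart_edge_eq_iff d d₀).1 h with rfl | rfl
        · rfl
        · exact add_comm _ _
    rw [Finset.sum_congr rfl fun d hd => by rw [(Finset.mem_filter.1 hd).2], Finset.sum_const,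
      hfib, Finset.card_pair d₀.symm_ne.symm, smul_eq_mul]
  · intro d _
    have := (him _).1 ⟨d.fst, d.snd, d.adj, rfl⟩
    simp only [Finset.mem_erase, Finset.mem_powerset]
    exact ⟨this.2.2, this.2.1.ne_empty, this.1⟩

lemma SimpleGraph.sum_dart_fst {V : Type*} [Fintype V] (G : SimpleGraph V) [DecidableRel G.Adj]
    (g : V → ℕ) : ∑ d : G.Dart, g d.fst = ∑ v, G.degree v * g v := by
  classical
  rw [← Finset.sum_fiberwise_of_maps_to (t := Finset.univ) (g := fun d : G.Dart => d.fst)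
    (fun _ _ => Finset.mem_univ _)]
  refine Finset.sum_congr rfl fun v _ => ?_
  rw [Finset.sum_congr rfl fun d hd => by rw [(Finset.mem_filter.1 hd).2], Finset.sum_const,
    G.dart_fst_fiber_card_eq_degree, smul_eq_mul]

lemma SimpleGraph.sum_dart_snd {V : Type*} [Fintype V] (G : SimpleGraph V) [DecidableRel G.Adj]
    (g : V → ℕ) : ∑ d : G.Dart, g d.snd = ∑ v, G.degree v * g v := by
  rw [← G.sum_dart_fst]
  exact Fintype.sum_bijective SimpleGraph.Dart.symm
    SimpleGraph.Dart.symm_involutive.bijective _ _ fun _ => rfl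

/-- A tree all of whose vertices but one are leaves is a star. -/
lemma SimpleGraph.IsTree.nonempty_iso_star {V : Type*} [Fintype V] {G : SimpleGraph V}
    [DecidableRel G.Adj] (hG : G.IsTree) (c : V) (hdeg : ∀ v, v ≠ c → G.degree v = 1) {k : ℕ}
    (hk : Fintype.card V = k + 1) :
    Nonempty (G ≃g completeBipartiteGraph (Fin 1) (Fin k)) := by
  classical
  have hc : G.degree c = k := by
    have h1 := G.sum_degrees_eq_twice_card_edges
    have h2 := hG.card_edgeFinset
    rw [← Finset.add_sum_erase _ _ (Finset.mem_univ c),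
      Finset.sum_congr rfl fun v hv => hdeg v (Finset.ne_of_mem_erase hv)] at h1
    simp only [Finset.sum_const, Finset.card_erase_of_mem (Finset.mem_univ c),
      Finset.card_univ, smul_eq_mul] at h1
    omega
  have hadjc : ∀ v, v ≠ c → G.Adj c v := by
    have : G.neighborFinset c = Finset.univ.erase c := by
      apply Finset.eq_of_subset_of_card_le
      · intro v hv
        exact Finset.mem_erase.2 ⟨((G.mem_neighborFinset _ _).1 hv).ne', Finset.mem_univ _⟩
      · rw [Finset.card_erase_of_mem (Finset.mem_univ c), Finset.card_univ,
          SimpleGraph.card_neighborFinset_eq_degree]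
        omega
    intro v hv
    rw [← G.mem_neighborFinset, this]
    simp [hv]
  have hleaf : ∀ u v, u ≠ c → G.Adj u v → v = c := by
    intro u v hu huv
    obtain ⟨w, -, hw⟩ := SimpleGraph.degree_eq_one_iff_existsUnique_adj.1 (hdeg u hu)
    rw [hw v huv, hw c (hadjc u hu).symm]
  have e₁ : {v // v = c} ≃ Fin 1 := Fintype.equivFinOfCardEq (Fintype.card_subtype_eq c)
  have e₂ : {v // ¬ v = c} ≃ Fin k := Fintype.equivFinOfCardEq (by
    rw [Fintype.card_subtype_compl, Fintype.card_subtype_eq, hk, Nat.add_sub_cancel])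
  refine ⟨⟨(Equiv.sumCompl (· = c)).symm.trans (Equiv.sumCongr e₁ e₂), ?_⟩⟩
  intro u v
  by_cases hu : u = c <;> by_cases hv : v = c
  · subst hu
    subst hv
    simp
  · have h := Equiv.sumCompl_symm_apply_of_neg (p := (· = c)) hv
    subst hu
    simp [h, hadjc v hv]
  · have h := Equiv.sumCompl_symm_apply_of_neg (p := (· = c)) hu
    subst hv
    simp [h, (hadjc u hu).symm]
  · have h₁ := Equiv.sumCompl_symm_apply_of_neg (p := (· = c)) hu
    have h₂ := Equiv.sumCompl_symm_apply_of_neg (p := (· = c)) hv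
    simpa [h₁, h₂] using fun h => hv (hleaf u v hu h)

theorem stmt_12 {V : Type*} [Fintype V] (G : SimpleGraph V)
    (hconn : G.Connected) (hac : G.IsAcyclic)
    (X : Finset ℕ) (hX : 2 ≤ X.card)
    (f : V → Finset ℕ) (hf : IsTopIASGL G X f) :
    Nonempty (G ≃g completeBipartiteGraph (Fin 1) (Fin (2 ^ X.card - 2))) := by
  classical
  obtain ⟨hf, -, -, hXT, -⟩ := hf
  have hsum := hf.sum_darts
  obtain ⟨hinj, hsub, -, him⟩ := hf
  have hXne : X.Nonempty := Finset.card_pos.1 (by omega)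
  have hX0 : X ≠ {0} := by
    rintro rfl
    simp at hX
  obtain ⟨v, hv⟩ : ∃ v, f v = X := by
    rcases hXT with h | h
    · exact absurd h hXne.ne_empty
    · exact h
  have : Nontrivial V := by
    obtain ⟨a, b, hab, -⟩ := (him X).2 ⟨subset_rfl, hXne, hX0⟩
    exact ⟨a, b, hab.ne⟩
  have hpos : ∀ v, 0 < G.degree v := fun v => hconn.preconnected.degree_pos_of_nontrivial v
  obtain ⟨c, hvc⟩ := (G.degree_pos_iff_exists_adj v).1 (hpos v)
  have hc : f c = {0} := by
    rw [eq_singleton_zero_iff_sup_id (hsub c).1]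
    have h := Finset.sup_mono (f := id) ((him _).1 ⟨v, c, hvc, rfl⟩).1
    rw [sup_id_add (hsub v).1 (hsub c).1, hv] at h
    omega
  have h0X : {0} ⊆ X := hc ▸ (hsub c).2
  have h0mem : ({0} : Finset ℕ) ∈ X.powerset.erase ∅ := by
    simpa using h0X
  have hpow : 4 ≤ 2 ^ X.card := Nat.pow_le_pow_right (n := 2) (by norm_num) hX
  have hcardP : (X.powerset.erase ∅).card = 2 ^ X.card - 1 := by
    rw [Finset.card_erase_of_mem (Finset.empty_mem_powerset X), Finset.card_powerset]
  have htree : G.IsTree := ⟨hconn, hac⟩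
  have hcardV : Fintype.card V = 2 ^ X.card - 2 + 1 := by
    have h1 := hsum fun _ => 1
    simp only [Finset.sum_const, smul_eq_mul, mul_one, Finset.card_univ,
      Finset.card_erase_of_mem h0mem, hcardP, G.dart_card_eq_twice_card_edges] at h1
    have h2 := htree.card_edgeFinset
    omega
  have himage : Finset.univ.image f = X.powerset.erase ∅ := by
    apply Finset.eq_of_subset_of_card_le
    · intro A hA
      obtain ⟨u, -, rfl⟩ := Finset.mem_image.1 hA
      simpa using ⟨(hsub u).1.ne_empty, (hsub u).2⟩
    · rw [Finset.card_image_of_injective _ hinj, hcardP, Finset.card_univ]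
      omega
  have hmax : ∑ u, (f u).sup id = ∑ u, G.degree u * (f u).sup id := by
    have h := hsum fun A => A.sup id
    simp only [sup_id_add (hsub _).1 (hsub _).1] at h
    rw [Finset.sum_add_distrib, G.sum_dart_fst fun u => (f u).sup id,
      G.sum_dart_snd fun u => (f u).sup id, Finset.sum_erase _ (by simp), ← himage,
      Finset.sum_image hinj.injOn] at h
    omega
  rw [Finset.sum_eq_sum_iff_of_le fun u _ => Nat.le_mul_of_pos_left _ (hpos u)] at hmax
  refine htree.nonempty_iso_star c (fun u hu => ?_) hcardV
  have hne : (f u).sup id ≠ 0 := by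
    rw [Ne, ← eq_singleton_zero_iff_sup_id (hsub u).1, ← hc]
    exact hinj.ne hu
  exact (Nat.eq_of_mul_eq_mul_right (Nat.pos_of_ne_zero hne)
    ((one_mul _).trans (hmax u (Finset.mem_univ u)))).symm
end

section
/- Suppose a graph G admits a topological integer additive set-graceful labeling with respect to a ground set X with |X| ≥ 2. Let ρ be the number of subsets A of X for which there exist nonempty subsets B and C of X with B ≠ C, B ≠ {0}, C ≠ {0}, and A = B + C. Then |E(G)| = 2^{|X|} − 2 and |V(G)| ≥ 2^{|X|} − (ρ + 1). -/
open Finset Pointwise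

/-- The edge labelling induced by a vertex labelling `f`, sending `s(u, v)` to `f u + f v`. -/
def sumsetLabel {V : Type*} (f : V → Finset ℕ) : Sym2 V → Finset ℕ :=
  Sym2.lift ⟨fun u v => f u + f v, fun _ _ => add_comm _ _⟩

theorem IsIASGL.exists_eq_singleton_zero {V : Type*} {G : SimpleGraph V} {X : Finset ℕ}
    {f : V → Finset ℕ} (hf : IsIASGL G X f) (hX : 2 ≤ X.card) : ∃ v, f v = {0} := by
  obtain ⟨-, hsub, -, him⟩ := hf
  have hne : (X.erase 0).Nonempty := by
    rw [← Finset.card_pos]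
    have := Finset.pred_card_le_card_erase (s := X) (a := 0)
    omega
  obtain ⟨a, ha, hmin⟩ := Finset.exists_min_image (X.erase 0) id hne
  rw [Finset.mem_erase] at ha
  obtain ⟨u, v, -, huv⟩ := (him {a}).2 ⟨by simpa using ha.2, by simp, by simpa using ha.1⟩
  have hsum : ∀ x ∈ f u, ∀ y ∈ f v, x + y = a := fun x hx y hy => by
    simpa [huv] using Finset.add_mem_add hx hy
  obtain ⟨b, hb⟩ := (hsub u).1
  obtain ⟨c, hc⟩ := (hsub v).1
  have hbc := hsum b hb c hc
  by_cases hb0 : b = 0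
  · refine ⟨u, Finset.eq_singleton_iff_unique_mem.2 ⟨hb0 ▸ hb, fun x hx => ?_⟩⟩
    have := hsum x hx c hc
    omega
  · have hba : a ≤ b := hmin b (Finset.mem_erase.2 ⟨hb0, (hsub u).2 hb⟩)
    have hc0 : c = 0 := by omega
    refine ⟨v, Finset.eq_singleton_iff_unique_mem.2 ⟨hc0 ▸ hc, fun y hy => ?_⟩⟩
    have := hsum b hb y hy
    omega

theorem IsIASGL.zero_mem {V : Type*} {G : SimpleGraph V} {X : Finset ℕ}
    {f : V → Finset ℕ} (hf : IsIASGL G X f) (hX : 2 ≤ X.card) : 0 ∈ X := by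
  obtain ⟨v, hv⟩ := hf.exists_eq_singleton_zero hX
  exact (hf.2.1 v).2 (by simp [hv])

theorem IsIASGL.card_edgeFinset {V : Type*} [Fintype V] [DecidableEq V] {G : SimpleGraph V}
    [DecidableRel G.Adj] {X : Finset ℕ} {f : V → Finset ℕ} (hf : IsIASGL G X f)
    (hX : 2 ≤ X.card) : G.edgeFinset.card = 2 ^ X.card - 2 := by
  have hzero := hf.zero_mem hX
  obtain ⟨-, -, hinj, him⟩ := hf
  have hcard : ((X.powerset.erase ∅).erase {0}).card = 2 ^ X.card - 2 := by
    rw [Finset.card_erase_of_mem (by simp [hzero]), Finset.card_erase_of_mem (by simp),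
      Finset.card_powerset]
    omega
  rw [← hcard]
  refine Finset.card_nbij (sumsetLabel f) ?_ ?_ ?_
  · intro e
    induction e with | _ u v =>
    intro he
    obtain ⟨h₁, h₂, h₃⟩ := (him _).1 ⟨u, v, by simpa using he, rfl⟩
    exact Finset.mem_erase.2 ⟨h₃, Finset.mem_erase.2 ⟨h₂.ne_empty, Finset.mem_powerset.2 h₁⟩⟩
  · intro e he e' he' h
    induction e with | _ u v =>
    induction e' with | _ u' v' =>
    exact hinj u v u' v' (by simpa using he) (by simpa using he') h
  · intro A hA
    simp only [Finset.mem_coe, Finset.mem_erase, Finset.mem_powerset] at hA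
    obtain ⟨u, v, huv, h⟩ := (him A).2 ⟨hA.2.2, Finset.nonempty_iff_ne_empty.2 hA.2.1, hA.1⟩
    exact ⟨s(u, v), by simpa using huv, h⟩

theorem stmt_14 {V : Type*} [Fintype V] [DecidableEq V] (G : SimpleGraph V)
    [DecidableRel G.Adj] (X : Finset ℕ) (hX : 2 ≤ X.card)
    (f : V → Finset ℕ) (hf : IsTopIASGL G X f)
    (ρ : ℕ)
    (hρ : ρ = Set.ncard {A : Finset ℕ | A ⊆ X ∧ ∃ B C : Finset ℕ, B ⊆ X ∧ C ⊆ X ∧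
      B.Nonempty ∧ C.Nonempty ∧ B ≠ C ∧ B ≠ ({0} : Finset ℕ) ∧ C ≠ ({0} : Finset ℕ) ∧
      A = B + C}) :
    G.edgeFinset.card = 2 ^ X.card - 2 ∧ 2 ^ X.card - (ρ + 1) ≤ Fintype.card V := by
  obtain ⟨hf, -⟩ := hf
  refine ⟨hf.card_edgeFinset hX, ?_⟩
  obtain ⟨v₀, hv₀⟩ := hf.exists_eq_singleton_zero hX
  obtain ⟨hfinj, hsub, -, him⟩ := hf
  set S := {A : Finset ℕ | A ⊆ X ∧ ∃ B C : Finset ℕ, B ⊆ X ∧ C ⊆ X ∧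
      B.Nonempty ∧ C.Nonempty ∧ B ≠ C ∧ B ≠ ({0} : Finset ℕ) ∧ C ≠ ({0} : Finset ℕ) ∧
      A = B + C}
  have hfin : S.Finite :=
    X.powerset.finite_toSet.subset fun A hA => Finset.mem_coe.2 (Finset.mem_powerset.2 hA.1)
  have hcover : X.powerset ⊆ insert ∅ (hfin.toFinset ∪ Finset.univ.image f) := by
    intro A hA
    rw [Finset.mem_powerset] at hA
    simp only [Finset.mem_insert, Finset.mem_union, Set.Finite.mem_toFinset, Finset.mem_image,
      Finset.mem_univ, true_and]
    by_cases hA0 : A = {0}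
    · exact .inr (.inr ⟨v₀, hv₀.trans hA0.symm⟩)
    obtain rfl | hne := A.eq_empty_or_nonempty
    · exact .inl rfl
    obtain ⟨u, v, huv, rfl⟩ := (him A).2 ⟨hA, hne, hA0⟩
    right
    by_cases hu : f u = {0}
    · exact .inr ⟨v, by rw [hu, Finset.singleton_zero, zero_add]⟩
    by_cases hv : f v = {0}
    · exact .inr ⟨u, by rw [hv, Finset.singleton_zero, add_zero]⟩
    exact .inl ⟨hA, f u, f v, (hsub u).2, (hsub v).2, (hsub u).1, (hsub v).1,
      fun h => huv.ne (hfinj h), hu, hv, rfl⟩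
  have hle := Finset.card_le_card hcover
  have h₁ := Finset.card_insert_le ∅ (hfin.toFinset ∪ Finset.univ.image f)
  have h₂ := Finset.card_union_le hfin.toFinset (Finset.univ.image f)
  have h₃ : (Finset.univ.image f).card ≤ Fintype.card V := Finset.card_image_le
  rw [Set.ncard_eq_toFinset_card S hfin] at hρ
  rw [Finset.card_powerset] at hle
  omega
end

section
/- For every n ≥ 3, the cycle graph C_n admits no topological integer additive set-graceful labeling with respect to any ground set X with |X| ≥ 2. -/
open Finset Pointwise

/-- A nonempty set of naturals whose sumset with `X` stays inside a nonempty `X` is `{0}`. -/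
theorem eq_singleton_zero_of_add_subset {A X : Finset ℕ} (hA : A.Nonempty) (hX : X.Nonempty)
    (h : A + X ⊆ X) : A = {0} := by
  refine Finset.eq_singleton_iff_nonempty_unique_mem.2 ⟨hA, fun a ha => ?_⟩
  have := X.le_max' _ (h (Finset.add_mem_add ha (X.max'_mem hX)))
  omega

/-- A graph with a topological IASGL with respect to a nonempty ground set has a vertex with at
most one neighbor, namely the vertex labeled by the whole ground set. -/
theorem IsTopIASGL.exists_subsingleton_neighborSet {V : Type*} {G : SimpleGraph V}
    {X : Finset ℕ} {f : V → Finset ℕ} (hf : IsTopIASGL G X f) (hX : X.Nonempty) :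
    ∃ v, (G.neighborSet v).Subsingleton := by
  obtain ⟨⟨hinj, hsub, -, hedge⟩, -, -, hXmem, -, -⟩ := hf
  obtain h | ⟨v, hv⟩ := hXmem
  · exact absurd h hX.ne_empty
  have key : ∀ u, G.Adj v u → f u = {0} := fun u hu => by
    refine eq_singleton_zero_of_add_subset (hsub u).1 hX ?_
    exact ((hedge (f u + X)).1 ⟨u, v, hu.symm, by rw [hv]⟩).1
  exact ⟨v, fun u hu w hw => hinj ((key u hu).trans (key w hw).symm)⟩

theorem stmt_16 (n : ℕ) (hn : 3 ≤ n) (X : Finset ℕ) (hX : 2 ≤ X.card) :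
    ¬ ∃ f : Fin n → Finset ℕ, IsTopIASGL (SimpleGraph.cycleGraph n) X f := by
  rintro ⟨f, hf⟩
  obtain ⟨v, hv⟩ := hf.exists_subsingleton_neighborSet (Finset.card_pos.1 (by omega))
  obtain ⟨m, rfl⟩ := Nat.exists_eq_add_of_le' hn
  have hdeg : (SimpleGraph.cycleGraph (m + 3)).degree v = 2 :=
    SimpleGraph.cycleGraph_degree_three_le
  rw [← SimpleGraph.card_neighborFinset_eq_degree] at hdeg
  obtain ⟨u, hu, w, hw, huw⟩ := Finset.one_lt_card.1 (hdeg ▸ Nat.one_lt_two)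
  rw [SimpleGraph.mem_neighborFinset] at hu hw
  exact huw (hv hu hw)
end
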